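/- arXiv:2010.15103 — 3 statements merged into one kernel-verified Lean document; each statement's English description precedes it below -/
import Mathlib

section
/- Let X be a nonempty finite set, d a positive natural number, A a finite type, and φ₀ : Fin d → ℂ a unit vector. For q ∈ ℕ, let V_q be the linear span, inside the complex vector space of functions γ : A × (X → Fin d) → ℂ, of all vectors ψ with the property that there exist a subset S ⊆ X with |S| ≤ q and a function ψ' : A × (S → Fin d) → ℂ such that ψ(a,f) = ψ'(a, f restricted to S) · ∏_{y∈X∖S} φ₀(f(y)) for all a and f. For x ∈ X and γ : A × (X → Fin d) → ℂ, define the contraction γ_x : A × ({y : X // y ≠ x} → Fin d) → ℂ by γ_x(a,g) = ∑_{v ∈ Fin d} conj(φ₀(v)) · γ(a, f_{g,v}), where f_{g,v} is the function sending x to v and every y ≠ x to g(y). Then for every vector γ ∈ V_q with ℓ² norm 1 and every probability mass function p on X, ∑_{x∈X} p(x)·‖γ_x‖² ≥ 1 − q·max_{x∈X} p(x). -/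
open scoped BigOperators

/-- The set of "product-form" states after at most `q` queries: there is a set `S` of at
most `q` oracle inputs such that the state factorizes as an arbitrary state on the
adversary register together with the registers in `S`, tensored with the fixed state `φ₀`
on every register outside of `S`. -/
def goodStates (X : Type*) [Fintype X] [DecidableEq X] (d : ℕ) (A : Type*)
    (φ₀ : Fin d → ℂ) (q : ℕ) : Set ((A × (X → Fin d)) → ℂ) :=
  {ψ | ∃ S : Finset X, S.card ≤ q ∧ ∃ ψ' : A × ({y : X // y ∈ S} → Fin d) → ℂ,
    ∀ (a : A) (f : X → Fin d),
      ψ (a, f) = ψ' (a, fun y => f y.1) * ∏ y ∈ Sᶜ, φ₀ (f y)}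

/-- The span of the possible adversary–oracle states after `q` queries to the
superposition oracle. -/
noncomputable def Vq (X : Type*) [Fintype X] [DecidableEq X] (d : ℕ) (A : Type*)
    (φ₀ : Fin d → ℂ) (q : ℕ) : Submodule ℂ ((A × (X → Fin d)) → ℂ) :=
  Submodule.span ℂ (goodStates X d A φ₀ q)

/-- The contraction of the register `x` against the vector `φ₀`. -/
noncomputable def contract {X : Type*} [DecidableEq X] {d : ℕ} {A : Type*}
    (φ₀ : Fin d → ℂ) (γ : (A × (X → Fin d)) → ℂ) (x : X) :
    (A × ({y : X // y ≠ x} → Fin d)) → ℂ :=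
  fun p => ∑ v : Fin d, (starRingEnd ℂ) (φ₀ v) *
    γ (p.1, fun y => if h : y = x then v else p.2 ⟨y, h⟩)

/-- For commuting linear maps `Q x` that split a nonnegative functional `n` in Pythagorean fashion,
every `γ` in the span of the vectors on which at most `q` of the maps are nonzero satisfies
`∑ x, n (Q x γ) ≤ q * n γ`. -/
theorem sum_le_mul_of_mem_span_card_le {X V : Type*} [DecidableEq X]
    [AddCommGroup V] [Module ℂ V] [DecidableEq V]
    (n : V → ℝ) (hn : ∀ v, 0 ≤ n v)
    (Q : X → V →ₗ[ℂ] V) (hcomm : ∀ x y v, Q x (Q y v) = Q y (Q x v))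
    (hpyth : ∀ x v, n v = n (Q x v) + n (v - Q x v)) (R : Finset X) (q : ℕ) (γ : V)
    (hγ : γ ∈ Submodule.span ℂ {ψ | (R.filter fun x => Q x ψ ≠ 0).card ≤ q}) :
    ∑ x ∈ R, n (Q x γ) ≤ q * n γ := by
  induction R using Finset.induction_on generalizing q γ with
  | empty => simpa using mul_nonneg q.cast_nonneg (hn γ)
  | insert x R hx ih =>
    have hcompl : γ - Q x γ ∈
        Submodule.span ℂ {ψ | (R.filter fun y => Q y ψ ≠ 0).card ≤ q} := by
      refine (Submodule.span_le (p := (Submodule.span ℂ _).comap (LinearMap.id - Q x))).2 ?_ hγ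
      intro ψ hψ
      refine Submodule.subset_span (le_trans (Finset.card_le_card ?_) hψ)
      intro y hy
      rw [Finset.mem_filter] at hy ⊢
      refine ⟨Finset.mem_insert_of_mem hy.1, fun h => hy.2 ?_⟩
      simp [hcomm y x, h]
    have hsplit : ∑ y ∈ R, n (Q y γ) =
        ∑ y ∈ R, n (Q y (Q x γ)) + ∑ y ∈ R, n (Q y (γ - Q x γ)) := by
      rw [← Finset.sum_add_distrib]
      refine Finset.sum_congr rfl fun y _ => ?_
      rw [hpyth x (Q y γ), hcomm x y, map_sub]
    have himage : ∑ y ∈ R, n (Q y (Q x γ)) + n (Q x γ) ≤ q * n (Q x γ) := by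
      cases q with
      | zero =>
        have hker : Q x γ = 0 := by
          refine (Submodule.span_le (p := LinearMap.ker (Q x))).2 ?_ hγ
          intro ψ hψ
          have hempty := Finset.card_eq_zero.1 (Nat.le_zero.1 hψ)
          by_contra h
          have : x ∈ (insert x R).filter fun y => Q y ψ ≠ 0 :=
            Finset.mem_filter.2 ⟨Finset.mem_insert_self x R, h⟩
          simp [hempty] at this
        have hzero : n 0 = 0 := by simpa using hpyth x 0
        simp [hker, hzero]
      | succ q =>
        have hmem : Q x γ ∈
            Submodule.span ℂ {ψ | (R.filter fun y => Q y ψ ≠ 0).card ≤ q} := by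
          refine (Submodule.span_le (p := (Submodule.span ℂ _).comap (Q x))).2 ?_ hγ
          intro ψ hψ
          by_cases h : Q x ψ = 0
          · simp [h]
          · refine Submodule.subset_span (le_trans (Finset.card_le_card
              (t := R.filter fun y => Q y ψ ≠ 0) ?_) ?_)
            · intro y hy
              rw [Finset.mem_filter] at hy ⊢
              refine ⟨hy.1, fun h => hy.2 ?_⟩
              rw [hcomm y x, h, map_zero]
            · rw [Set.mem_ofPred_eq, Finset.filter_insert, if_pos h, Finset.card_insert_of_notMem
                (fun h => hx (Finset.mem_filter.1 h).1)] at hψ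
              exact Nat.le_of_succ_le_succ hψ
        have := ih q (Q x γ) hmem
        push_cast
        linarith
    have := ih q _ hcompl
    rw [Finset.sum_insert hx, hsplit, hpyth x γ]
    linarith

/-- The projection of the register `x` onto the vector `φ₀`. -/
noncomputable def registerProj {X : Type*} [DecidableEq X] {d : ℕ} {A : Type*}
    (φ₀ : Fin d → ℂ) (x : X) :
    ((A × (X → Fin d)) → ℂ) →ₗ[ℂ] ((A × (X → Fin d)) → ℂ) where
  toFun γ z := φ₀ (z.2 x) * ∑ v, (starRingEnd ℂ) (φ₀ v) * γ (z.1, Function.update z.2 x v)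
  map_add' γ δ := by
    funext z
    simp [mul_add, Finset.sum_add_distrib]
  map_smul' c γ := by
    funext z
    simp only [Pi.smul_apply, smul_eq_mul, RingHom.id_apply, Finset.mul_sum]
    exact Finset.sum_congr rfl fun v _ => by ring

section registerProj

variable {X : Type*} [DecidableEq X] {d : ℕ} {A : Type*} (φ₀ : Fin d → ℂ)

theorem registerProj_apply (x : X) (γ : (A × (X → Fin d)) → ℂ) (a : A) (f : X → Fin d) :
    registerProj φ₀ x γ (a, f) =
      φ₀ (f x) * ∑ v, (starRingEnd ℂ) (φ₀ v) * γ (a, Function.update f x v) := rfl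

theorem registerProj_comm (x y : X) (γ : (A × (X → Fin d)) → ℂ) :
    registerProj φ₀ x (registerProj φ₀ y γ) = registerProj φ₀ y (registerProj φ₀ x γ) := by
  obtain rfl | hxy := eq_or_ne x y
  · rfl
  funext ⟨a, f⟩
  simp only [registerProj_apply, Function.update_of_ne hxy, Function.update_of_ne hxy.symm,
    Finset.mul_sum]
  rw [Finset.sum_comm]
  refine Finset.sum_congr rfl fun v _ => Finset.sum_congr rfl fun w _ => ?_
  rw [Function.update_comm hxy]
  ring

theorem registerProj_apply_extend (x : X) (γ : (A × (X → Fin d)) → ℂ)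
    (a : A) (g : {y : X // y ≠ x} → Fin d) (v : Fin d) :
    registerProj φ₀ x γ (a, fun y => if h : y = x then v else g ⟨y, h⟩) =
      φ₀ v * contract φ₀ γ x (a, g) := by
  simp only [registerProj_apply, contract, dite_true]
  congr 1
  refine Finset.sum_congr rfl fun w _ => ?_
  congr 3
  funext y
  by_cases h : y = x
  · subst h
    simp
  · simp [h]

theorem sum_eq_sum_extend [Fintype X] [Fintype A] (x : X) (F : (A × (X → Fin d)) → ℝ) :
    ∑ z, F z = ∑ z : A × ({y : X // y ≠ x} → Fin d), ∑ v,
      F (z.1, fun y => if h : y = x then v else z.2 ⟨y, h⟩) := by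
  simp only [Fintype.sum_prod_type]
  refine Finset.sum_congr rfl fun a _ => ?_
  rw [Finset.sum_comm, ← Fintype.sum_prod_type', ← (Equiv.funSplitAt x (Fin d)).symm.sum_comp]
  refine Finset.sum_congr rfl fun u _ => congrArg (fun f => F (a, f)) (funext fun y => ?_)
  simp [Equiv.funSplitAt, Equiv.piSplitAt]

variable {φ₀}

theorem sum_norm_sq_eq_add_sum_norm_sub_sq (hφ : ∑ v, ‖φ₀ v‖ ^ 2 = 1) (h : Fin d → ℂ) :
    ∑ v, ‖h v‖ ^ 2 = ‖∑ v, (starRingEnd ℂ) (φ₀ v) * h v‖ ^ 2 +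
      ∑ v, ‖h v - φ₀ v * ∑ w, (starRingEnd ℂ) (φ₀ w) * h w‖ ^ 2 := by
  set c := ∑ v, (starRingEnd ℂ) (φ₀ v) * h v with hc
  have hφ' : ∑ v, (starRingEnd ℂ) (φ₀ v) * φ₀ v = 1 := by
    simp only [Complex.conj_mul']
    exact_mod_cast hφ
  have hc' : ∑ v, (starRingEnd ℂ) (h v) * φ₀ v = (starRingEnd ℂ) c := by
    simp [hc, mul_comm]
  have hterm (v : Fin d) : (starRingEnd ℂ) (h v - φ₀ v * c) * (h v - φ₀ v * c) =
      (starRingEnd ℂ) (h v) * h v - (starRingEnd ℂ) (h v) * φ₀ v * c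
      - (starRingEnd ℂ) (φ₀ v) * h v * (starRingEnd ℂ) c
      + (starRingEnd ℂ) (φ₀ v) * φ₀ v * ((starRingEnd ℂ) c * c) := by
    simp only [map_sub, map_mul]
    ring
  apply Complex.ofReal_injective
  push_cast
  simp only [← Complex.conj_mul', hterm, Finset.sum_add_distrib, Finset.sum_sub_distrib,
    ← Finset.sum_mul]
  rw [hφ', hc', ← hc]
  ring

theorem registerProj_eq_self [Fintype X] (hφ : ∑ v, ‖φ₀ v‖ ^ 2 = 1)
    {S : Finset X} {x : X} (hx : x ∉ S)
    {ψ : (A × (X → Fin d)) → ℂ} {ψ' : A × ({y : X // y ∈ S} → Fin d) → ℂ}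
    (hψ : ∀ a f, ψ (a, f) = ψ' (a, fun y => f y.1) * ∏ y ∈ Sᶜ, φ₀ (f y)) :
    registerProj φ₀ x ψ = ψ := by
  funext ⟨a, f⟩
  have hφ' : ∑ v, (starRingEnd ℂ) (φ₀ v) * φ₀ v = 1 := by
    simp only [Complex.conj_mul']
    exact_mod_cast hφ
  have hxS : x ∈ Sᶜ := Finset.mem_compl.2 hx
  have hupdate (v : Fin d) : ψ (a, Function.update f x v) =
      φ₀ v * (ψ' (a, fun y => f y.1) * ∏ y ∈ Sᶜ.erase x, φ₀ (f y)) := by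
    have hrest : (fun y : {y : X // y ∈ S} => Function.update f x v y.1) = fun y => f y.1 :=
      funext fun y => Function.update_of_ne (ne_of_mem_of_not_mem y.2 hx) _ _
    rw [hψ, hrest, ← Finset.mul_prod_erase _ _ hxS, Function.update_self,
      Finset.prod_congr rfl fun y hy => by
        rw [Function.update_of_ne (Finset.ne_of_mem_erase hy)]]
    ring
  simp only [registerProj_apply, hupdate, ← mul_assoc, ← Finset.sum_mul, hφ', one_mul]
  rw [hψ, ← Finset.mul_prod_erase _ _ hxS]
  ring

variable [Fintype X] [Fintype A]

theorem sum_norm_sq_registerProj (hφ : ∑ v, ‖φ₀ v‖ ^ 2 = 1) (x : X)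
    (γ : (A × (X → Fin d)) → ℂ) :
    ∑ z, ‖registerProj φ₀ x γ z‖ ^ 2 = ∑ z, ‖contract φ₀ γ x z‖ ^ 2 := by
  rw [sum_eq_sum_extend x]
  simp only [registerProj_apply_extend, norm_mul, mul_pow, ← Finset.sum_mul, hφ, one_mul]

theorem sum_norm_sq_eq_contract_add (hφ : ∑ v, ‖φ₀ v‖ ^ 2 = 1) (x : X)
    (γ : (A × (X → Fin d)) → ℂ) :
    ∑ z, ‖γ z‖ ^ 2 = ∑ z, ‖contract φ₀ γ x z‖ ^ 2 +
      ∑ z, ‖(γ - registerProj φ₀ x γ) z‖ ^ 2 := by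
  rw [sum_eq_sum_extend x, sum_eq_sum_extend x fun z => ‖(γ - registerProj φ₀ x γ) z‖ ^ 2,
    ← Finset.sum_add_distrib]
  refine Finset.sum_congr rfl fun z _ => ?_
  simp only [Pi.sub_apply, registerProj_apply_extend]
  exact sum_norm_sq_eq_add_sum_norm_sub_sq hφ _

end registerProj

theorem expected_overlap_ge
    (X : Type*) [Fintype X] [DecidableEq X] [Nonempty X]
    (d : ℕ) (hd : 0 < d) (A : Type*) [Fintype A]
    (φ₀ : Fin d → ℂ) (hφ : ∑ v, ‖φ₀ v‖ ^ 2 = 1)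
    (q : ℕ) (γ : (A × (X → Fin d)) → ℂ)
    (hγV : γ ∈ Vq X d A φ₀ q)
    (hγ : ∑ z, ‖γ z‖ ^ 2 = 1)
    (p : X → ℝ) (hp0 : ∀ x, 0 ≤ p x) (hp1 : ∑ x, p x = 1) :
    ∑ x, p x * (∑ z, ‖contract φ₀ γ x z‖ ^ 2) ≥
      1 - q * Finset.univ.sup' Finset.univ_nonempty p := by
  let Q : X → ((A × (X → Fin d)) → ℂ) →ₗ[ℂ] ((A × (X → Fin d)) → ℂ) :=
    fun x => LinearMap.id - registerProj φ₀ x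
  let n : ((A × (X → Fin d)) → ℂ) → ℝ := fun ψ => ∑ z, ‖ψ z‖ ^ 2
  have hcomm (x y : X) (ψ) : Q x (Q y ψ) = Q y (Q x ψ) := by
    simp only [Q, LinearMap.sub_apply, LinearMap.id_apply, map_sub, registerProj_comm φ₀ x y]
    abel
  have hpyth (x : X) (ψ) : n ψ = n (Q x ψ) + n (ψ - Q x ψ) := by
    have hproj : ψ - Q x ψ = registerProj φ₀ x ψ := sub_sub_cancel _ _
    rw [hproj, add_comm]
    exact (sum_norm_sq_eq_contract_add hφ x ψ).trans
      (congrArg (· + n (Q x ψ)) (sum_norm_sq_registerProj hφ x ψ).symm)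
  have hsum : ∑ x, n (Q x γ) ≤ q := by
    have := sum_le_mul_of_mem_span_card_le n (fun ψ => by positivity) Q hcomm hpyth
      Finset.univ q γ (Submodule.span_mono ?_ hγV)
    · simpa only [n, hγ, mul_one] using this
    rintro ψ ⟨S, hS, ψ', hψ⟩
    refine le_trans (Finset.card_le_card fun x hx => ?_) hS
    by_contra hxS
    exact (Finset.mem_filter.1 hx).2 (sub_eq_zero.2 (registerProj_eq_self hφ hxS hψ).symm)
  have hcontract (x : X) : ∑ z, ‖contract φ₀ γ x z‖ ^ 2 = 1 - n (Q x γ) :=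
    eq_sub_of_add_eq ((sum_norm_sq_eq_contract_add hφ x γ).symm.trans hγ)
  set M := Finset.univ.sup' Finset.univ_nonempty p
  have hpM (x : X) : p x ≤ M := Finset.le_sup' p (Finset.mem_univ x)
  have hM : 0 ≤ M := (hp0 (Classical.arbitrary X)).trans (hpM _)
  have hweighted : ∑ x, p x * n (Q x γ) ≤ q * M := calc
    _ ≤ ∑ x, M * n (Q x γ) := Finset.sum_le_sum fun x _ =>
        mul_le_mul_of_nonneg_right (hpM x) (by positivity)
    _ = (∑ x, n (Q x γ)) * M := by rw [← Finset.mul_sum, mul_comm]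
    _ ≤ q * M := mul_le_mul_of_nonneg_right hsum hM
  simp only [hcontract, mul_sub, mul_one, Finset.sum_sub_distrib, hp1]
  linarith
end

section
/- Let N and q be natural numbers with 0 < q < N, and let S be a subset of Fin N with exactly q elements. In the real Euclidean space ℝ^N with standard basis (e_x), let u = (1/√N)·∑_{x} e_x, s = (1/√q)·∑_{x∈S} e_x, s̄ = (1/√(N−q))·∑_{x∉S} e_x, and v = (1/√2)·(s + s̄). Then the inner product ⟪v, u⟫ equals q/√(2·N·q) + (N−q)/√(2·N² − 2·N·q), and consequently ⟪v, u⟫² = 1/2 + √(q·(N−q))/N. -/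
open scoped RealInnerProductSpace

/-- The inner product of an indicator vector with the all-ones vector counts the support. -/
theorem inner_sum_single_sum_single {ι : Type*} [Fintype ι] [DecidableEq ι] (A : Finset ι) :
    ⟪∑ x ∈ A, EuclideanSpace.single x (1 : ℝ), ∑ x, EuclideanSpace.single x (1 : ℝ)⟫ =
      (A.card : ℝ) := by
  simp [sum_inner, EuclideanSpace.inner_single_left]

theorem attack_inner_product
    (N q : ℕ) (hq : 0 < q) (hqN : q < N)
    (S : Finset (Fin N)) (hS : S.card = q)
    (e : Fin N → EuclideanSpace ℝ (Fin N))
    (he : ∀ x, e x = EuclideanSpace.single x 1)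
    (u s sbar v : EuclideanSpace ℝ (Fin N))
    (hu : u = (1 / Real.sqrt N) • ∑ x, e x)
    (hs : s = (1 / Real.sqrt q) • ∑ x ∈ S, e x)
    (hsbar : sbar = (1 / Real.sqrt ((N : ℝ) - q)) • ∑ x ∈ Sᶜ, e x)
    (hv : v = (1 / Real.sqrt 2) • (s + sbar)) :
    ⟪v, u⟫ = (q : ℝ) / Real.sqrt (2 * N * q)
        + ((N : ℝ) - q) / Real.sqrt (2 * (N : ℝ) ^ 2 - 2 * N * q) ∧
    ⟪v, u⟫ ^ 2 = 1 / 2 + Real.sqrt (q * ((N : ℝ) - q)) / N := by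
  obtain rfl : e = fun x => EuclideanSpace.single x 1 := funext he
  have hq0 : (0 : ℝ) < q := by exact_mod_cast hq
  have hr0 : (0 : ℝ) < (N : ℝ) - q := sub_pos.mpr (by exact_mod_cast hqN)
  have hN0 : (0 : ℝ) < N := by linarith
  have hSc : ((Sᶜ.card : ℕ) : ℝ) = (N : ℝ) - q := by
    rw [Finset.card_compl, Fintype.card_fin, hS, Nat.cast_sub hqN.le]
  have ha := Real.sqrt_pos.mpr hq0
  have hb := Real.sqrt_pos.mpr hr0
  have hn := Real.sqrt_pos.mpr hN0
  have ht : 0 < √(2 : ℝ) := Real.sqrt_pos.mpr two_pos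
  have ha2 := Real.sq_sqrt hq0.le
  have hb2 := Real.sq_sqrt hr0.le
  have hn2 := Real.sq_sqrt hN0.le
  have ht2 : √(2 : ℝ) ^ 2 = 2 := Real.sq_sqrt zero_le_two
  have hinner : ⟪v, u⟫ = (√(q : ℝ) + √((N : ℝ) - q)) / (√2 * √(N : ℝ)) := by
    rw [hv, hu, hs, hsbar]
    simp only [inner_smul_left, inner_smul_right, inner_add_left, inner_sum_single_sum_single,
      hS, hSc, conj_trivial]
    field_simp
    linear_combination (-√((N : ℝ) - q)) * ha2 - √(q : ℝ) * hb2
  refine ⟨?_, ?_⟩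
  · rw [hinner, show 2 * (N : ℝ) ^ 2 - 2 * N * q = 2 * N * (N - q) by ring,
      Real.sqrt_mul (by positivity) (q : ℝ), Real.sqrt_mul (by positivity) ((N : ℝ) - q),
      Real.sqrt_mul zero_le_two]
    field_simp
    linear_combination √((N : ℝ) - q) * ha2 + √(q : ℝ) * hb2
  · rw [hinner, Real.sqrt_mul hq0.le, div_pow, mul_pow, ht2, hn2, add_sq, ha2, hb2]
    field_simp
    ring
end

section
/- For all natural numbers n and q with 1 ≤ q and 8·q < 2ⁿ, the following inequality holds over the reals: (q/√(2^{n+1}·q) + (2ⁿ − q)/√(2^{2n+1} − 2^{n+1}·q))² ≥ 1/2 + √q/(2·√(2ⁿ)). -/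
theorem sq_div_sqrt_add_div_sqrt {N q : ℝ} (hq : 0 < q) (hqN : q < N) :
    (q / √(2 * N * q) + (N - q) / √(2 * N * (N - q))) ^ 2
      = 1 / 2 + √q * √(N - q) / N := by
  have hN : 0 < N := hq.trans hqN
  have hd : 0 < N - q := sub_pos.mpr hqN
  have key : ∀ x : ℝ, 0 < x → x / √(2 * N * x) = √x / √(2 * N) := fun x hx => by
    rw [Real.sqrt_mul (by positivity), div_mul_eq_div_div_swap, Real.div_sqrt]
  rw [key q hq, key _ hd, ← add_div, div_pow, Real.sq_sqrt (by positivity), add_sq,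
    Real.sq_sqrt hq.le, Real.sq_sqrt hd.le]
  field_simp
  ring

theorem sqrt_div_two_mul_sqrt_le {N q : ℝ} (hN : 0 < N) (hqN : 4 * q ≤ 3 * N) :
    √q / (2 * √N) ≤ √q * √(N - q) / N := by
  have hs : 0 < √N := Real.sqrt_pos.mpr hN
  have hb : √N / 2 ≤ √(N - q) := by
    apply Real.le_sqrt_of_sq_le
    rw [div_pow, Real.sq_sqrt hN.le]
    linarith
  calc √q / (2 * √N) = √q * (√N / 2) / (√N * √N) := by field_simp
    _ = √q * (√N / 2) / N := by rw [Real.mul_self_sqrt hN.le]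
    _ ≤ √q * √(N - q) / N := by gcongr

theorem attack_probability_bound
    (n q : ℕ) (hq : 1 ≤ q) (hqn : 8 * q < 2 ^ n) :
    ((q : ℝ) / Real.sqrt (2 ^ (n + 1) * q)
        + ((2 : ℝ) ^ n - q) / Real.sqrt (2 ^ (2 * n + 1) - 2 ^ (n + 1) * q)) ^ 2
      ≥ 1 / 2 + Real.sqrt q / (2 * Real.sqrt (2 ^ n)) := by
  have hq0 : (0 : ℝ) < q := by exact_mod_cast hq
  have hqN : 8 * (q : ℝ) < 2 ^ n := by exact_mod_cast hqn
  have h₁ : (2 : ℝ) ^ (n + 1) * q = 2 * 2 ^ n * q := by ring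
  have h₂ : (2 : ℝ) ^ (2 * n + 1) - 2 * 2 ^ n * q = 2 * 2 ^ n * (2 ^ n - q) := by ring
  rw [h₁, h₂, sq_div_sqrt_add_div_sqrt hq0 (by linarith)]
  have h₃ := sqrt_div_two_mul_sqrt_le (N := 2 ^ n) (q := q) (by positivity) (by linarith)
  linarith
end
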